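/- Let φ be a nonnegative function in L¹_loc(0,∞). Then the Hausdorff operator H_φ, defined by H_φ f(x) = ∫₀^∞ f(x/t) φ(t)/t dt, is bounded on BMO(ℝ) if and only if ∫₀^∞ t^{−1} φ(t) dt < ∞. Moreover, in that case, the operator norm of H_φ on BMO(ℝ) equals ∫₀^∞ t^{−1} φ(t) dt. -/

import Mathlib

open MeasureTheory Complex Filter Set Topology ENNReal NNReal

/-- The BMO seminorm on `ℝ`: the supremum over bounded intervals `(a,b)` of the mean
oscillation of `f` over `(a,b)`. -/
noncomputable def bmoNorm (f : ℝ → ℝ) : ℝ≥0∞ :=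
  ⨆ (a : ℝ) (b : ℝ) (_ : a < b),
    ENNReal.ofReal ((b - a)⁻¹ *
      ∫ x in Set.Ioo a b, |f x - (b - a)⁻¹ * ∫ y in Set.Ioo a b, f y|)

/-- Membership in `BMO(ℝ)`: locally integrable functions with finite BMO seminorm. -/
def MemBMO (f : ℝ → ℝ) : Prop :=
  LocallyIntegrable f volume ∧ bmoNorm f < ⊤

/-- The Hausdorff operator `H_φ f (x) = ∫₀^∞ f(x/t) φ(t)/t dt` on real-valued
functions. -/
noncomputable def hausdorffRR (φ : ℝ → ℝ) (f : ℝ → ℝ) (x : ℝ) : ℝ :=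
  ∫ t in Set.Ioi (0 : ℝ), (φ t / t) * f (x / t)

/-- mean oscillation bound from the BMO norm -/
lemma osc_le_of_memBMO {f : ℝ → ℝ} (hf : bmoNorm f < ⊤) {a b : ℝ} (hab : a < b) :
    (∫ x in Set.Ioo a b, |f x - (b - a)⁻¹ * ∫ y in Set.Ioo a b, f y|)
      ≤ (b - a) * (bmoNorm f).toReal := by
  have h1 : ENNReal.ofReal ((b - a)⁻¹ *
      ∫ x in Set.Ioo a b, |f x - (b - a)⁻¹ * ∫ y in Set.Ioo a b, f y|) ≤ bmoNorm f := by
    unfold bmoNorm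
    exact le_iSup_of_le a (le_iSup_of_le b (le_iSup_of_le hab le_rfl))
  rw [ENNReal.ofReal_le_iff_le_toReal hf.ne] at h1
  have hp : 0 < b - a := sub_pos.2 hab
  rwa [inv_mul_le_iff₀ hp] at h1

lemma Ioo_integral_comp_div (g : ℝ → ℝ) {a b t : ℝ} (hab : a < b) (ht : 0 < t) :
    (∫ x in Set.Ioo a b, g (x / t)) = t * ∫ x in Set.Ioo (a / t) (b / t), g x := by
  have h := intervalIntegral.integral_comp_div (a := a) (b := b) g ht.ne'
  rw [intervalIntegral.integral_of_le hab.le, intervalIntegral.integral_of_le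
    (div_le_div_of_nonneg_right hab.le ht.le), integral_Ioc_eq_integral_Ioo,
    integral_Ioc_eq_integral_Ioo] at h
  simpa using h

/-- mean of the dilate -/
noncomputable def dilMean (f : ℝ → ℝ) (a b t : ℝ) : ℝ :=
  (b - a)⁻¹ * ∫ x in Set.Ioo a b, f (x / t)

lemma dilMean_eq (f : ℝ → ℝ) {a b t : ℝ} (hab : a < b) (ht : 0 < t) :
    dilMean f a b t = (b / t - a / t)⁻¹ * ∫ x in Set.Ioo (a / t) (b / t), f x := by
  have hp : 0 < b - a := sub_pos.2 hab
  rw [dilMean, Ioo_integral_comp_div f hab ht, ← _root_.sub_div]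
  field_simp

lemma dil_osc_le {f : ℝ → ℝ} (hf : bmoNorm f < ⊤) {a b t : ℝ} (hab : a < b) (ht : 0 < t) :
    (∫ x in Set.Ioo a b, |f (x / t) - dilMean f a b t|) ≤ (b - a) * (bmoNorm f).toReal := by
  have hab' : a / t < b / t := div_lt_div_of_pos_right hab ht
  have h := osc_le_of_memBMO hf hab'
  rw [← dilMean_eq f hab ht] at h
  rw [Ioo_integral_comp_div (fun y => |f y - dilMean f a b t|) hab ht]
  calc _ ≤ t * ((b / t - a / t) * (bmoNorm f).toReal) := by gcongr
    _ = _ := by field_simp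

lemma qmp_div_const {t : ℝ} (ht : 0 < t) :
    Measure.QuasiMeasurePreserving (fun x : ℝ => x / t) volume volume := by
  refine ⟨by fun_prop, ?_⟩
  have : (fun x : ℝ => x / t) = (· * t⁻¹) := by ext x; simp [div_eq_mul_inv]
  rw [this, Real.map_volume_mul_right (inv_ne_zero ht.ne')]
  exact Measure.smul_absolutelyContinuous

lemma qmp_div (a b : ℝ) :
    Measure.QuasiMeasurePreserving (fun p : ℝ × ℝ => p.1 / p.2)
      ((volume.restrict (Set.Ioo a b)).prod (volume.restrict (Set.Ioi 0))) volume := by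
  apply QuasiMeasurePreserving.prod_of_left
  · fun_prop
  · filter_upwards [ae_restrict_mem measurableSet_Ioi] with t ht
    exact (qmp_div_const ht).mono_left Measure.restrict_le_self.absolutelyContinuous

lemma dil_integrableOn {f : ℝ → ℝ} (hf : LocallyIntegrable f volume) {a b t : ℝ}
    (hab : a < b) (ht : 0 < t) : IntegrableOn (fun x => f (x / t)) (Set.Ioo a b) := by
  have h1 : IntegrableOn f (Set.Icc (a / t) (b / t)) := hf.integrableOn_isCompact isCompact_Icc
  have h2 : IntervalIntegrable f volume (a / t) (b / t) := by
    rw [intervalIntegrable_iff_integrableOn_Icc_of_le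
      (div_le_div_of_nonneg_right hab.le ht.le)]
    exact h1
  have h3 := h2.comp_mul_right (c := t⁻¹)
  have h4 : IntervalIntegrable (fun x => f (x / t)) volume a b := by
    simpa [div_eq_mul_inv, ht.ne'] using h3
  exact (intervalIntegrable_iff_integrableOn_Ioo_of_le hab.le).1 h4

/-- The local structure of `H_φ f` on an interval. -/
lemma hausdorff_local {φ : ℝ → ℝ} (hφ : ∀ t, 0 ≤ φ t)
    (hint : IntegrableOn (fun t : ℝ => φ t / t) (Set.Ioi 0)) {f : ℝ → ℝ} (hf : MemBMO f)
    {a b : ℝ} (hab : a < b) :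
    IntegrableOn (hausdorffRR φ f) (Set.Ioo a b) ∧
    (∫ x in Set.Ioo a b, |hausdorffRR φ f x - (b - a)⁻¹ * ∫ y in Set.Ioo a b, hausdorffRR φ f y|)
      ≤ (b - a) * ((∫ t in Set.Ioi (0 : ℝ), φ t / t) * (bmoNorm f).toReal) := by
  have hp : 0 < b - a := sub_pos.2 hab
  set μ := (volume.restrict (Set.Ioo a b) : Measure ℝ) with hμ
  set ν := (volume.restrict (Set.Ioi (0:ℝ)) : Measure ℝ) with hν
  set K := (bmoNorm f).toReal with hK
  have hK0 : 0 ≤ K := ENNReal.toReal_nonneg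
  set c := dilMean f a b with hc
  have hfm : AEStronglyMeasurable (fun p : ℝ × ℝ => f (p.1 / p.2)) (μ.prod ν) :=
    hf.1.aestronglyMeasurable.comp_quasiMeasurePreserving (qmp_div a b)
  have hcm : AEStronglyMeasurable c ν := by
    have : AEStronglyMeasurable (fun t => ∫ x, f (x / t) ∂μ) ν :=
      hfm.prod_swap.integral_prod_right'
    exact this.const_mul _
  have hψ : Integrable (fun t => φ t / t) ν := hint
  have hψ0 : ∀ᵐ t ∂ν, 0 ≤ φ t / t := by
    filter_upwards [ae_restrict_mem measurableSet_Ioi] with t ht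
    exact div_nonneg (hφ t) (le_of_lt ht)
  have hψc : AEStronglyMeasurable (fun t => φ t / t * c t) ν := hψ.aestronglyMeasurable.mul hcm
  let F : ℝ × ℝ → ℝ := fun p => φ p.2 / p.2 * (f (p.1 / p.2) - c p.2)
  have hFm : AEStronglyMeasurable F (μ.prod ν) :=
    (hψ.aestronglyMeasurable.comp_snd).mul (hfm.sub hcm.comp_snd)
  have hsec : ∀ t, 0 < t → Integrable (fun x => f (x / t) - c t) μ := fun t ht =>
    (dil_integrableOn hf.1 hab ht).sub (integrable_const _)
  have hnorm : ∀ t, 0 < t → (∫ x, ‖F (x, t)‖ ∂μ) ≤ φ t / t * ((b - a) * K) := by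
    intro t ht
    have h0 : 0 ≤ φ t / t := div_nonneg (hφ t) ht.le
    have : (∫ x, ‖F (x, t)‖ ∂μ) = φ t / t * ∫ x, |f (x / t) - c t| ∂μ := by
      rw [← integral_const_mul]
      congr 1; ext x
      simp only [F, norm_mul, Real.norm_eq_abs, abs_of_nonneg h0]
    rw [this]
    exact mul_le_mul_of_nonneg_left (dil_osc_le hf.2 hab ht) h0
  have hFi : Integrable F (μ.prod ν) := by
    rw [integrable_prod_iff' hFm]
    constructor
    · filter_upwards [ae_restrict_mem measurableSet_Ioi] with t ht
      exact (hsec t ht).const_mul (φ t / t)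
    · refine (hψ.mul_const ((b - a) * K)).mono' ?_ ?_
      · exact hFm.norm.prod_swap.integral_prod_right'
      · filter_upwards [ae_restrict_mem measurableSet_Ioi] with t ht
        rw [Real.norm_of_nonneg (integral_nonneg fun _ => norm_nonneg _)]
        exact hnorm t ht
  let g : ℝ → ℝ := fun x => ∫ t, F (x, t) ∂ν
  have hg : Integrable g μ := hFi.integral_prod_left
  have hg0 : ∫ x, g x ∂μ = 0 := by
    have h1 : ∫ x, g x ∂μ = ∫ t, ∫ x, F (x, t) ∂μ ∂ν :=
      integral_integral_swap (f := fun x t => F (x, t)) hFi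
    rw [h1]
    apply integral_eq_zero_of_ae
    filter_upwards [ae_restrict_mem measurableSet_Ioi] with t ht
    simp only [F, Pi.zero_apply]
    rw [integral_const_mul, integral_sub (dil_integrableOn hf.1 hab ht) (integrable_const _),
      integral_const]
    have : c t = (b - a)⁻¹ * ∫ x, f (x / t) ∂μ := rfl
    rw [this]
    simp [hμ, hp.le]
    right
    field_simp
    simp
  have hgabs : ∫ x, |g x| ∂μ ≤ (b - a) * ((∫ t, φ t / t ∂ν) * K) := by
    calc ∫ x, |g x| ∂μ ≤ ∫ x, ∫ t, ‖F (x, t)‖ ∂ν ∂μ := by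
          apply integral_mono hg.abs hFi.integral_norm_prod_left
          intro x
          exact norm_integral_le_integral_norm (fun t => F (x, t))
      _ = ∫ t, ∫ x, ‖F (x, t)‖ ∂μ ∂ν :=
          integral_integral_swap (f := fun x t => ‖F (x, t)‖) hFi.norm
      _ ≤ ∫ t, φ t / t * ((b - a) * K) ∂ν := by
          apply integral_mono_ae hFi.norm.integral_prod_right (hψ.mul_const _)
          filter_upwards [ae_restrict_mem measurableSet_Ioi] with t ht
          exact hnorm t ht
      _ = _ := by rw [integral_mul_const]; ring
  have hsl : ∀ᵐ x ∂μ, Integrable (fun t => F (x, t)) ν := hFi.prod_right_ae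
  have hrhs : 0 ≤ (b - a) * ((∫ t, φ t / t ∂ν) * K) :=
    mul_nonneg hp.le (mul_nonneg (integral_nonneg_of_ae hψ0) hK0)
  by_cases hci : Integrable (fun t => φ t / t * c t) ν
  · set m := ∫ t, φ t / t * c t ∂ν with hm
    have hH : hausdorffRR φ f =ᵐ[μ] fun x => g x + m := by
      filter_upwards [hsl] with x hx
      simp only [g, hm]
      rw [← integral_add hx hci]
      unfold hausdorffRR
      congr 1; ext t; simp only [F]; ring
    have hHi : Integrable (hausdorffRR φ f) μ := (hg.add (integrable_const m)).congr hH.symm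
    refine ⟨hHi, ?_⟩
    have hmean : (b - a)⁻¹ * ∫ y, hausdorffRR φ f y ∂μ = m := by
      rw [integral_congr_ae hH, integral_add hg (integrable_const m), hg0]
      simp [hμ, hp.le]
      field_simp
    rw [hmean]
    refine le_trans (le_of_eq ?_) hgabs
    apply integral_congr_ae
    filter_upwards [hH] with x hx
    rw [hx]; simp
  · have hH : hausdorffRR φ f =ᵐ[μ] fun _ => 0 := by
      filter_upwards [hsl] with x hx
      unfold hausdorffRR
      apply integral_undef
      intro hi
      apply hci
      refine (hi.sub hx).congr (ae_of_all _ fun t => ?_)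
      simp only [F, Pi.sub_apply]; ring
    refine ⟨(integrable_zero _ _ _).congr hH.symm, ?_⟩
    have hz : ∫ y, hausdorffRR φ f y ∂μ = 0 := by
      rw [integral_congr_ae hH]; simp
    rw [hz]
    refine le_trans (le_of_eq ?_) hrhs
    apply integral_eq_zero_of_ae
    filter_upwards [hH] with x hx
    rw [hx]; simp

lemma hausdorff_upper {φ : ℝ → ℝ} (hφ : ∀ t, 0 ≤ φ t)
    (hint : IntegrableOn (fun t : ℝ => φ t / t) (Set.Ioi 0)) {f : ℝ → ℝ} (hf : MemBMO f) :
    MemBMO (hausdorffRR φ f) ∧ bmoNorm (hausdorffRR φ f) ≤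
      ENNReal.ofReal (∫ t in Set.Ioi (0 : ℝ), φ t / t) * bmoNorm f := by
  have hI : 0 ≤ ∫ t in Set.Ioi (0 : ℝ), φ t / t :=
    setIntegral_nonneg measurableSet_Ioi fun t ht => div_nonneg (hφ t) (le_of_lt ht)
  have hle : bmoNorm (hausdorffRR φ f) ≤
      ENNReal.ofReal (∫ t in Set.Ioi (0 : ℝ), φ t / t) * bmoNorm f := by
    conv_lhs => unfold bmoNorm
    refine iSup_le fun a => iSup_le fun b => iSup_le fun hab => ?_
    have hp : 0 < b - a := sub_pos.2 hab
    rw [← ENNReal.ofReal_toReal hf.2.ne, ← ENNReal.ofReal_mul hI]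
    apply ENNReal.ofReal_le_ofReal
    rw [inv_mul_le_iff₀ hp]
    exact (hausdorff_local hφ hint hf hab).2
  refine ⟨⟨?_, hle.trans_lt (ENNReal.mul_lt_top ENNReal.ofReal_lt_top hf.2)⟩, hle⟩
  intro x
  refine ⟨Set.Ioo (x - 1) (x + 1), Ioo_mem_nhds (by linarith) (by linarith), ?_⟩
  exact (hausdorff_local hφ hint hf (by linarith)).1

lemma bmoNorm_le_one {f : ℝ → ℝ} (hfm : Measurable f) (hf : ∀ x, |f x| ≤ 1) :
    bmoNorm f ≤ 1 := by
  unfold bmoNorm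
  refine iSup_le fun a => iSup_le fun b => iSup_le fun hab => ?_
  have hp : 0 < b - a := sub_pos.2 hab
  rw [← ENNReal.ofReal_one]
  apply ENNReal.ofReal_le_ofReal
  rw [inv_mul_le_iff₀ hp]
  set μ := (volume.restrict (Set.Ioo a b) : Measure ℝ) with hμ
  have hfi : Integrable f μ :=
    (integrable_const (1:ℝ)).mono' hfm.aestronglyMeasurable (ae_of_all _ hf)
  set m := (b - a)⁻¹ * ∫ y, f y ∂μ with hm
  have hm' : ∫ y, f y ∂μ = (b - a) * m := by rw [hm]; field_simp
  have hri : Integrable (fun x => (2 + m ^ 2) / 2 - m * f x) μ :=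
    (integrable_const _).sub (hfi.const_mul m)
  calc ∫ x, |f x - m| ∂μ ≤ ∫ x, ((2 + m ^ 2) / 2 - m * f x) ∂μ := by
        apply integral_mono (hfi.sub (integrable_const m)).abs hri
        intro x
        have h1 := abs_le.1 (hf x)
        have h2 : f x ^ 2 ≤ 1 := by nlinarith
        change |f x - m| ≤ (2 + m ^ 2) / 2 - m * f x
        rw [abs_le]
        constructor <;> nlinarith [sq_nonneg (f x - m - 1), sq_nonneg (f x - m + 1)]
    _ = (b - a) * ((2 + m ^ 2) / 2) - m * ((b - a) * m) := by
        rw [integral_sub (integrable_const _) (hfi.const_mul m), integral_const_mul, hm']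
        simp [hμ, hp.le]
    _ ≤ (b - a) * 1 := by nlinarith [mul_nonneg hp.le (sq_nonneg m)]

/-- test function -/
noncomputable def testFn (A B : ℝ) (x : ℝ) : ℝ :=
  (Set.Ioo A B).indicator (fun _ => (1 : ℝ)) x - (Set.Ioo A B).indicator (fun _ => (1 : ℝ)) (-x)

lemma testFn_measurable (A B : ℝ) : Measurable (testFn A B) := by
  have h : Measurable ((Set.Ioo A B).indicator (fun _ => (1 : ℝ))) :=
    measurable_const.indicator measurableSet_Ioo
  exact h.sub (h.comp measurable_neg)

lemma testFn_neg (A B x : ℝ) : testFn A B (-x) = - testFn A B x := by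
  simp [testFn]

lemma testFn_abs_le (A B x : ℝ) : |testFn A B x| ≤ 1 := by
  unfold testFn Set.indicator
  split_ifs <;> simp

lemma testFn_pos {A B x : ℝ} (hA : 0 < A) (hx : 0 < x) :
    testFn A B x = (Set.Ioo A B).indicator (fun _ => (1 : ℝ)) x := by
  unfold testFn
  rw [Set.indicator_of_notMem (a := -x), sub_zero]
  intro h
  have := h.1
  linarith

lemma testFn_memBMO (A B : ℝ) : MemBMO (testFn A B) := by
  refine ⟨?_, (bmoNorm_le_one (testFn_measurable A B) (testFn_abs_le A B)).trans_lt
    ENNReal.one_lt_top⟩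
  exact (locallyIntegrable_const (1:ℝ)).mono (testFn_measurable A B).aestronglyMeasurable
    (ae_of_all _ fun x => by simpa using testFn_abs_le A B x)

lemma hausdorff_neg (φ : ℝ → ℝ) (A B x : ℝ) :
    hausdorffRR φ (testFn A B) (-x) = - hausdorffRR φ (testFn A B) x := by
  unfold hausdorffRR
  rw [← integral_neg]
  congr 1; ext t
  rw [neg_div, testFn_neg]; ring

lemma psi_integrableOn {φ : ℝ → ℝ} (hloc : LocallyIntegrableOn φ (Set.Ioi 0)) {α β : ℝ}
    (hα : 0 < α) : IntegrableOn (fun t => φ t / t) (Set.Icc α β) := by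
  have h : IntegrableOn φ (Set.Icc α β) :=
    hloc.integrableOn_compact_subset (fun t ht => lt_of_lt_of_le hα ht.1) isCompact_Icc
  have hc : ContinuousOn (fun t : ℝ => t⁻¹) (Set.Icc α β) :=
    continuousOn_inv₀.mono fun t ht => (lt_of_lt_of_le hα ht.1).ne'
  simpa [div_eq_mul_inv] using h.mul_continuousOn hc isCompact_Icc

lemma hausdorff_test_ge {φ : ℝ → ℝ} (hφ : ∀ t, 0 ≤ φ t)
    (hloc : LocallyIntegrableOn φ (Set.Ioi 0)) {α β δ x : ℝ} (hα : 0 < α) (hαβ : α < β)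
    (hδ : 0 < δ) (hx : δ < x) (hx1 : x < 1) :
    (∫ t in Set.Icc α β, φ t / t) ≤ hausdorffRR φ (testFn (δ / (2 * β)) (2 / α)) x := by
  have hβ : 0 < β := hα.trans hαβ
  have hx0 : 0 < x := hδ.trans hx
  set A := δ / (2 * β) with hA
  set B := 2 / α with hB
  have hA0 : 0 < A := by positivity
  have hB0 : 0 < B := by positivity
  have hsub : Set.Icc α β ⊆ Set.Ioi 0 := fun t ht => lt_of_lt_of_le hα ht.1
  have heq : ∀ t, 0 < t → φ t / t * testFn A B (x / t) =
      (Set.Ioo (x / B) (x / A)).indicator (fun t => φ t / t) t := by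
    intro t ht
    rw [testFn_pos hA0 (div_pos hx0 ht)]
    have hiff : x / t ∈ Set.Ioo A B ↔ t ∈ Set.Ioo (x / B) (x / A) := by
      simp only [Set.mem_Ioo]
      rw [lt_div_iff₀ ht, div_lt_iff₀ ht, div_lt_iff₀ hB0, lt_div_iff₀ hA0]
      constructor <;> rintro ⟨h1, h2⟩ <;> constructor <;> linarith
    by_cases h : x / t ∈ Set.Ioo A B
    · rw [Set.indicator_of_mem h, Set.indicator_of_mem (hiff.1 h), mul_one]
    · rw [Set.indicator_of_notMem h, Set.indicator_of_notMem (fun h' => h (hiff.2 h')), mul_zero]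
  have hI : IntegrableOn (fun t => φ t / t) (Set.Ioo (x / B) (x / A)) :=
    (psi_integrableOn hloc (div_pos hx0 hB0)).mono_set Set.Ioo_subset_Icc_self
  have hpos : Set.Ioo (x / B) (x / A) ⊆ Set.Ioi 0 := fun t ht => (div_pos hx0 hB0).trans ht.1
  have hH : hausdorffRR φ (testFn A B) x = ∫ t in Set.Ioo (x / B) (x / A), φ t / t := by
    unfold hausdorffRR
    rw [setIntegral_congr_fun measurableSet_Ioi heq, setIntegral_indicator measurableSet_Ioo,
      Set.inter_eq_right.2 hpos]
  rw [hH]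
  apply setIntegral_mono_set hI
  · filter_upwards [ae_restrict_mem measurableSet_Ioo] with t ht
    exact div_nonneg (hφ t) (le_of_lt (hpos ht))
  · refine ae_of_all _ fun t ht => ?_
    constructor
    · rw [div_lt_iff₀ hB0, hB]
      have : t * (2 / α) ≥ α * (2 / α) := by gcongr; exact ht.1
      have h2 : α * (2 / α) = 2 := by field_simp
      linarith
    · rw [lt_div_iff₀ hA0, hA]
      have : t * (δ / (2 * β)) ≤ β * (δ / (2 * β)) := by gcongr; exact ht.2
      have h2 : β * (δ / (2 * β)) = δ / 2 := by field_simp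
      linarith

lemma lower_compact {φ : ℝ → ℝ} (hφ : ∀ t, 0 ≤ φ t)
    (hloc : LocallyIntegrableOn φ (Set.Ioi 0)) {C : ℝ≥0∞} (hC : C ≠ ⊤)
    (h : ∀ f : ℝ → ℝ, MemBMO f →
        MemBMO (hausdorffRR φ f) ∧ bmoNorm (hausdorffRR φ f) ≤ C * bmoNorm f)
    {α β : ℝ} (hα : 0 < α) (hαβ : α < β) :
    (∫ t in Set.Icc α β, φ t / t) ≤ C.toReal := by
  set I := ∫ t in Set.Icc α β, φ t / t with hI
  have hI0 : 0 ≤ I := setIntegral_nonneg measurableSet_Icc fun t ht =>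
    div_nonneg (hφ t) (hα.le.trans ht.1)
  have key : ∀ δ, 0 < δ → δ < 1 → (1 - δ) * I ≤ C.toReal := by
    intro δ hδ hδ1
    set f := testFn (δ / (2 * β)) (2 / α) with hf
    obtain ⟨hm, hn⟩ := h f (testFn_memBMO _ _)
    have hn1 : bmoNorm (hausdorffRR φ f) ≤ C := by
      refine hn.trans ?_
      calc C * bmoNorm f ≤ C * 1 := by
            gcongr
            exact bmoNorm_le_one (testFn_measurable _ _) (testFn_abs_le _ _)
        _ = C := mul_one C
    have hn2 : (bmoNorm (hausdorffRR φ f)).toReal ≤ C.toReal := ENNReal.toReal_mono hC hn1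
    have hosc := osc_le_of_memBMO hm.2 (show (-1:ℝ) < 1 by norm_num)
    have hz : ∫ y in Set.Ioo (-1:ℝ) 1, hausdorffRR φ f y = 0 := by
      have h1 := intervalIntegral.integral_comp_neg (a := (-1:ℝ)) (b := 1) (hausdorffRR φ f)
      simp only [hf, hausdorff_neg, intervalIntegral.integral_neg, neg_neg] at h1
      rw [← hf] at h1
      rw [← integral_Ioc_eq_integral_Ioo, ← intervalIntegral.integral_of_le (by norm_num)]
      linarith
    rw [hz] at hosc
    simp only [mul_zero, sub_zero] at hosc
    have hii : IntegrableOn (fun x => |hausdorffRR φ f x|) (Set.Ioo (-1) 1) :=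
      ((hm.1.integrableOn_isCompact (isCompact_Icc (a := (-1:ℝ)) (b := 1))).mono_set
        Set.Ioo_subset_Icc_self).abs
    set S : Set ℝ := Set.Ioo (-1) (-δ) ∪ Set.Ioo δ 1 with hS
    have hSsub : S ⊆ Set.Ioo (-1) 1 := by
      rintro x (hx | hx)
      · exact ⟨hx.1, by linarith [hx.2]⟩
      · exact ⟨by linarith [hx.1], hx.2⟩
    have hge : ∀ x ∈ S, I ≤ |hausdorffRR φ f x| := by
      rintro x (hx | hx)
      · have := hausdorff_test_ge hφ hloc hα hαβ hδ (x := -x) (by linarith [hx.2])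
          (by linarith [hx.1])
        rw [hausdorff_neg] at this
        exact this.trans (neg_le_abs _)
      · exact (hausdorff_test_ge hφ hloc hα hαβ hδ hx.1 hx.2).trans (le_abs_self _)
    have hSm : MeasurableSet S := measurableSet_Ioo.union measurableSet_Ioo
    have hvol : volume.real S = 2 * (1 - δ) := by
      rw [hS, measureReal_union ?_ measurableSet_Ioo (by simp) (by simp)]
      · rw [Real.volume_real_Ioo_of_le (by linarith), Real.volume_real_Ioo_of_le (by linarith)]
        ring
      · rw [Set.disjoint_left]
        intro x h1 h2
        linarith [h1.2, h2.1]
    have hSfin : volume S ≠ ⊤ :=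
      ((measure_mono hSsub).trans_lt (by simp)).ne
    have hlow : I * volume.real S ≤ ∫ x in S, |hausdorffRR φ f x| := by
      have : ∫ x in S, I = I * volume.real S := by
        rw [setIntegral_const, smul_eq_mul, mul_comm]
      rw [← this]
      exact setIntegral_mono_on (integrableOn_const hSfin) (hii.mono_set hSsub) hSm hge
    have hmono : ∫ x in S, |hausdorffRR φ f x| ≤ ∫ x in Set.Ioo (-1) 1, |hausdorffRR φ f x| :=
      setIntegral_mono_set hii (ae_of_all _ fun _ => abs_nonneg _) hSsub.eventuallyLE
    rw [hvol] at hlow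
    linarith
  by_contra hcon
  push Not at hcon
  have hc0 : 0 ≤ C.toReal := ENNReal.toReal_nonneg
  have hIp : 0 < I := hc0.trans_lt hcon
  have := key ((I - C.toReal) / (2 * I)) (div_pos (by linarith) (by linarith))
    (by rw [div_lt_one (by linarith)]; linarith)
  have h2 : (1 - (I - C.toReal) / (2 * I)) * I = (I + C.toReal) / 2 := by
    field_simp; ring
  linarith

lemma lower_bound {φ : ℝ → ℝ} (hφ : ∀ t, 0 ≤ φ t)
    (hloc : LocallyIntegrableOn φ (Set.Ioi 0)) {C : ℝ≥0∞} (hC : C ≠ ⊤)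
    (h : ∀ f : ℝ → ℝ, MemBMO f →
        MemBMO (hausdorffRR φ f) ∧ bmoNorm (hausdorffRR φ f) ≤ C * bmoNorm f) :
    ∫⁻ t in Set.Ioi (0 : ℝ), ENNReal.ofReal (φ t / t) ≤ C := by
  let S : ℕ → Set ℝ := fun n => Set.Icc (((n : ℝ) + 2)⁻¹) ((n : ℝ) + 2)
  have hU : Set.Ioi (0:ℝ) = ⋃ n, S n := by
    ext t
    simp only [Set.mem_Ioi, Set.mem_iUnion, S, Set.mem_Icc]
    constructor
    · intro ht
      obtain ⟨n, hn⟩ := exists_nat_ge (max t t⁻¹)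
      refine ⟨n, ?_, ?_⟩
      · rw [inv_le_comm₀ (by positivity) ht]
        linarith [le_max_right t t⁻¹]
      · linarith [le_max_left t t⁻¹]
    · rintro ⟨n, h1, h2⟩
      exact lt_of_lt_of_le (by positivity) h1
  have hmono : Monotone S := by
    intro m n hmn
    have : (m : ℝ) ≤ n := by exact_mod_cast hmn
    apply Set.Icc_subset_Icc
    · gcongr
    · gcongr
  rw [hU, setLIntegral_iUnion_of_directed _ hmono.directed_le]
  refine iSup_le fun n => ?_
  have hpos : (0:ℝ) < ((n : ℝ) + 2)⁻¹ := by positivity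
  have hlt : ((n : ℝ) + 2)⁻¹ < (n : ℝ) + 2 := by
    have : ((n : ℝ) + 2)⁻¹ < 1 := inv_lt_one_of_one_lt₀ (by linarith [n.cast_nonneg (α := ℝ)])
    linarith [n.cast_nonneg (α := ℝ)]
  have h1 := lower_compact hφ hloc hC h hpos hlt
  rw [← ofReal_integral_eq_lintegral_ofReal (psi_integrableOn hloc hpos)]
  · exact ENNReal.ofReal_le_of_le_toReal h1
  · filter_upwards [ae_restrict_mem measurableSet_Icc] with t ht
    exact div_nonneg (hφ t) (hpos.le.trans ht.1)

/-- Theorem 3.8(ii): `H_φ` is bounded on `BMO(ℝ)` iff `∫₀^∞ t⁻¹ φ(t) dt < ∞`, and in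
that case its operator norm on `BMO(ℝ)` equals `∫₀^∞ t⁻¹ φ(t) dt`. -/
theorem hausdorff_bounded_BMO_iff_and_norm (φ : ℝ → ℝ) (hφ : ∀ t, 0 ≤ φ t)
    (hloc : LocallyIntegrableOn φ (Set.Ioi 0)) :
    ((∃ C : ℝ≥0∞, C < ⊤ ∧ ∀ f : ℝ → ℝ, MemBMO f →
        MemBMO (hausdorffRR φ f) ∧ bmoNorm (hausdorffRR φ f) ≤ C * bmoNorm f) ↔
      IntegrableOn (fun t : ℝ => φ t / t) (Set.Ioi 0)) ∧
    (IntegrableOn (fun t : ℝ => φ t / t) (Set.Ioi 0) →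
      sInf {C : ℝ≥0∞ | ∀ f : ℝ → ℝ, MemBMO f →
          bmoNorm (hausdorffRR φ f) ≤ C * bmoNorm f} =
        ENNReal.ofReal (∫ t in Set.Ioi (0 : ℝ), φ t / t)) := by
  have hnn : ∀ᵐ t ∂(volume.restrict (Set.Ioi (0:ℝ))), 0 ≤ φ t / t := by
    filter_upwards [ae_restrict_mem measurableSet_Ioi] with t ht
    exact div_nonneg (hφ t) (le_of_lt ht)
  refine ⟨⟨?_, fun hint => ⟨_, ENNReal.ofReal_lt_top, fun f hf => hausdorff_upper hφ hint hf⟩⟩,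
    fun hint => le_antisymm ?_ ?_⟩
  · rintro ⟨C, hC, h⟩
    have hl := lower_bound hφ hloc hC.ne h
    have hm : AEStronglyMeasurable (fun t => φ t / t) (volume.restrict (Set.Ioi (0:ℝ))) :=
      (hloc.aestronglyMeasurable.aemeasurable.div aemeasurable_id).aestronglyMeasurable
    refine ⟨hm, ?_⟩
    rw [hasFiniteIntegral_iff_ofReal hnn]
    exact hl.trans_lt hC
  · exact sInf_le fun f hf => (hausdorff_upper hφ hint hf).2
  · refine le_sInf fun C hC => ?_
    by_cases hCt : C = ⊤
    · rw [hCt]; exact le_top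
    rw [ofReal_integral_eq_lintegral_ofReal hint hnn]
    exact lower_bound hφ hloc hCt fun f hf => ⟨(hausdorff_upper hφ hint hf).1, hC f hf⟩
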